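/- The 3-sphere (10¹₍₃₂,₃₃₎) with facet list F0={0,3,5,6,8}, F1={0,4,5,7,8}, F2={0,3,4,6,7}, F3={0,1,3,5,7}, F4={1,3,5,8,9}, F5={1,3,6,7,9}, F6={0,2,4,6,8}, F7={2,4,6,7,9}, F8={2,4,5,8,9}, F9={1,4,5,7,9}, F10={2,3,6,8,9} (subsets of Fin 10) has no polytopal realization; i.e., there is no injective v : Fin 10 → ℝ⁴ such that every v j is an extreme point of P = convexHull ℝ (Set.range v) and the set of facets (3-dimensional proper faces) of P equals { convexHull ℝ (v '' F_i) : 0 ≤ i ≤ 10 }. -/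

import Mathlib

open Module

/-- The facet list of the 3-sphere `(10¹₍₃₂,₃₃₎)`. -/
def facets : Fin 11 → Set (Fin 10) :=
  ![{0,3,5,6,8}, {0,4,5,7,8}, {0,3,4,6,7}, {0,1,3,5,7}, {1,3,5,8,9},
    {1,3,6,7,9}, {0,2,4,6,8}, {2,4,6,7,9}, {2,4,5,8,9}, {1,4,5,7,9},
    {2,3,6,8,9}]

/-- Slack functional of a facet. -/
theorem slack_aux (v : Fin 10 → EuclideanSpace ℝ (Fin 4)) (hinj : Function.Injective v)
    (hext : ∀ j, v j ∉ convexHull ℝ (convexHull ℝ (Set.range v) \ {v j}))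
    (S : Set (Fin 10))
    (hne : convexHull ℝ (v '' S) ≠ ∅)
    (hexp : IsExposed ℝ (convexHull ℝ (Set.range v)) (convexHull ℝ (v '' S))) :
    ∃ (l : EuclideanSpace ℝ (Fin 4) →L[ℝ] ℝ) (c : ℝ),
      (∀ j, j ∈ S → c - l (v j) = 0) ∧ (∀ j, j ∉ S → 0 < c - l (v j)) := by
  obtain ⟨l, hl⟩ := hexp (Set.nonempty_iff_ne_empty.mpr hne)
  obtain ⟨x, hx⟩ := Set.nonempty_iff_ne_empty.mpr hne
  have hP : ∀ j, v j ∈ convexHull ℝ (Set.range v) := fun j =>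
    subset_convexHull ℝ _ (Set.mem_range_self j)
  have hx' := hx
  rw [hl] at hx'
  refine ⟨l, l x, fun j hj => ?_, fun j hj => ?_⟩
  · have h1 : v j ∈ convexHull ℝ (v '' S) :=
      subset_convexHull ℝ _ (Set.mem_image_of_mem v hj)
    rw [hl] at h1
    have h2 := h1.2 x hx'.1
    have h3 := hx'.2 (v j) (hP j)
    linarith
  · have h3 := hx'.2 (v j) (hP j)
    rcases lt_or_eq_of_le h3 with h | h
    · linarith
    · exfalso
      have h1 : v j ∈ convexHull ℝ (v '' S) := by
        rw [hl]
        exact ⟨hP j, fun y hy => by rw [h]; exact hx'.2 y hy⟩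
      refine hext j (convexHull_mono ?_ h1)
      rintro _ ⟨k, hk, rfl⟩
      refine ⟨hP k, fun hkj => hj ?_⟩
      rw [← hinj hkj]
      exact hk

/-- Affine dependency of five points in a three-dimensional set. -/
theorem dep_aux (p : Fin 5 → EuclideanSpace ℝ (Fin 4)) (S : Set (EuclideanSpace ℝ (Fin 4)))
    (hS : Set.range p ⊆ S)
    (h : finrank ℝ (vectorSpan ℝ (convexHull ℝ S)) = 3) :
    ∃ w : Fin 5 → ℝ, w ≠ 0 ∧
      ∀ (l : EuclideanSpace ℝ (Fin 4) →L[ℝ] ℝ) (c : ℝ), ∑ i, w i * (c - l (p i)) = 0 := by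
  have hn : ¬ AffineIndependent ℝ p := by
    intro hp
    have h4 := hp.finrank_vectorSpan (n := 4) (by simp)
    have hle : vectorSpan ℝ (Set.range p) ≤ vectorSpan ℝ (convexHull ℝ S) :=
      vectorSpan_mono ℝ (hS.trans (subset_convexHull ℝ S))
    have := Submodule.finrank_mono hle
    omega
  rw [affineIndependent_iff_of_fintype] at hn
  push Not at hn
  obtain ⟨w, hw0, hw, i, hi⟩ := hn
  refine ⟨w, fun h0 => hi (by simp [h0]), fun l c => ?_⟩
  rw [Finset.weightedVSub_eq_linear_combination _ hw0] at hw
  have h2 : l (∑ i, w i • p i) = 0 := by rw [hw]; simp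
  simp only [map_sum, map_smul, smul_eq_mul] at h2
  simp only [mul_sub, Finset.sum_sub_distrib, h2, ← Finset.sum_mul, hw0]
  simp

/-- Opposite signs. -/
theorem opp_aux {a b s t : ℝ} (hs : 0 < s) (ht : 0 < t) (h : a * s + b * t = 0) :
    ∃ k : ℝ, 0 < k ∧ a = - (k * b) :=
  ⟨t / s, by positivity, by field_simp; linarith⟩

/-- The 3-sphere `(10¹₍₃₂,₃₃₎)` has no polytopal realization. -/
theorem sphere_10_32_33_11_b_not_polytopal :
    ¬ ∃ v : Fin 10 → EuclideanSpace ℝ (Fin 4),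
      Function.Injective v ∧
      (∀ j, v j ∈ convexHull ℝ (Set.range v) ∧
        v j ∉ convexHull ℝ (convexHull ℝ (Set.range v) \ {v j})) ∧
      {F : Set (EuclideanSpace ℝ (Fin 4)) |
          F ≠ ∅ ∧ F ≠ convexHull ℝ (Set.range v) ∧
          IsExposed ℝ (convexHull ℝ (Set.range v)) F ∧
          finrank ℝ (vectorSpan ℝ F) = 3} =
        Set.range (fun i : Fin 11 => convexHull ℝ (v '' facets i)) := by
  rintro ⟨v, hinj, hext, hF⟩
  have hfac : ∀ i : Fin 11, convexHull ℝ (v '' facets i) ∈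
      {F : Set (EuclideanSpace ℝ (Fin 4)) |
          F ≠ ∅ ∧ F ≠ convexHull ℝ (Set.range v) ∧
          IsExposed ℝ (convexHull ℝ (Set.range v)) F ∧
          finrank ℝ (vectorSpan ℝ F) = 3} := fun i => by
    rw [hF]; exact ⟨i, rfl⟩
  choose l c hz hp using fun i => slack_aux v hinj (fun j => (hext j).2) (facets i)
    (hfac i).1 (hfac i).2.2.1
  obtain ⟨w, hw, hwl⟩ := dep_aux (v ∘ ![0,4,5,7,8]) (v '' facets 1)
    (by rintro _ ⟨i, rfl⟩; exact Set.mem_image_of_mem v (by fin_cases i <;> simp [facets]))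
    (hfac 1).2.2.2
  obtain ⟨u, hu, hul⟩ := dep_aux (v ∘ ![0,3,4,6,7]) (v '' facets 2)
    (by rintro _ ⟨i, rfl⟩; exact Set.mem_image_of_mem v (by fin_cases i <;> simp [facets]))
    (hfac 2).2.2.2
  generalize hs : (fun i j => c i - l i (v j)) = s at *
  have hse : ∀ i j, c i - l i (v j) = s i j := fun i j => by rw [← hs]
  have hW : ∀ i, w 0 * s i 0 + w 1 * s i 4 + w 2 * s i 5 + w 3 * s i 7 + w 4 * s i 8 = 0 := by
    intro i
    have := hwl (l i) (c i)
    simpa [Fin.sum_univ_five, hse] using this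
  have hU : ∀ i, u 0 * s i 0 + u 1 * s i 3 + u 2 * s i 4 + u 3 * s i 6 + u 4 * s i 7 = 0 := by
    intro i
    have := hul (l i) (c i)
    simpa [Fin.sum_univ_five, hse] using this
  have Z : ∀ i j, j ∈ facets i → s i j = 0 := fun i j h => by rw [← hse]; exact hz i j h
  have Q : ∀ i j, j ∉ facets i → 0 < s i j := fun i j h => by rw [← hse]; exact hp i j h
  clear hz hp hse hwl hul
  obtain ⟨a1, a1p, a1e⟩ : ∃ k : ℝ, 0 < k ∧ w 1 = - (k * w 3) := by
    have h := hW 0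
    rw [Z 0 0 (by simp [facets]), Z 0 5 (by simp [facets]), Z 0 8 (by simp [facets])] at h
    exact opp_aux (Q 0 4 (by simp [facets])) (Q 0 7 (by simp [facets])) (by linarith)
  obtain ⟨a2, a2p, a2e⟩ : ∃ k : ℝ, 0 < k ∧ w 0 = - (k * w 3) := by
    have h := hW 8
    rw [Z 8 4 (by simp [facets]), Z 8 5 (by simp [facets]), Z 8 8 (by simp [facets])] at h
    exact opp_aux (Q 8 0 (by simp [facets])) (Q 8 7 (by simp [facets])) (by linarith)
  obtain ⟨a3, a3p, a3e⟩ : ∃ k : ℝ, 0 < k ∧ w 4 = - (k * w 0) := by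
    have h := hW 9
    rw [Z 9 4 (by simp [facets]), Z 9 5 (by simp [facets]), Z 9 7 (by simp [facets])] at h
    exact opp_aux (Q 9 8 (by simp [facets])) (Q 9 0 (by simp [facets])) (by linarith)
  obtain ⟨a4, a4p, a4e⟩ : ∃ k : ℝ, 0 < k ∧ w 2 = - (k * w 3) := by
    have h := hW 6
    rw [Z 6 0 (by simp [facets]), Z 6 4 (by simp [facets]), Z 6 8 (by simp [facets])] at h
    exact opp_aux (Q 6 5 (by simp [facets])) (Q 6 7 (by simp [facets])) (by linarith)
  obtain ⟨b1, b1p, b1e⟩ : ∃ k : ℝ, 0 < k ∧ u 2 = - (k * u 4) := by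
    have h := hU 0
    rw [Z 0 0 (by simp [facets]), Z 0 3 (by simp [facets]), Z 0 6 (by simp [facets])] at h
    exact opp_aux (Q 0 4 (by simp [facets])) (Q 0 7 (by simp [facets])) (by linarith)
  obtain ⟨b2, b2p, b2e⟩ : ∃ k : ℝ, 0 < k ∧ u 1 = - (k * u 4) := by
    have h := hU 6
    rw [Z 6 0 (by simp [facets]), Z 6 4 (by simp [facets]), Z 6 6 (by simp [facets])] at h
    exact opp_aux (Q 6 3 (by simp [facets])) (Q 6 7 (by simp [facets])) (by linarith)
  obtain ⟨b3, b3p, b3e⟩ : ∃ k : ℝ, 0 < k ∧ u 0 = - (k * u 1) := by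
    have h := hU 7
    rw [Z 7 4 (by simp [facets]), Z 7 6 (by simp [facets]), Z 7 7 (by simp [facets])] at h
    exact opp_aux (Q 7 0 (by simp [facets])) (Q 7 3 (by simp [facets])) (by linarith)
  obtain ⟨b4, b4p, b4e⟩ : ∃ k : ℝ, 0 < k ∧ u 3 = - (k * u 2) := by
    have h := hU 3
    rw [Z 3 0 (by simp [facets]), Z 3 3 (by simp [facets]), Z 3 7 (by simp [facets])] at h
    exact opp_aux (Q 3 6 (by simp [facets])) (Q 3 4 (by simp [facets])) (by linarith)
  have hw3 : w 3 ≠ 0 := by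
    intro h0
    apply hw
    rw [h0] at a1e a2e a4e
    have e0 : w 0 = 0 := by simpa using a2e
    rw [e0] at a3e
    funext i
    fin_cases i <;> simp_all
  have hu4 : u 4 ≠ 0 := by
    intro h0
    apply hu
    rw [h0] at b1e b2e
    have e1 : u 1 = 0 := by simpa using b2e
    have e2 : u 2 = 0 := by simpa using b1e
    rw [e1] at b3e
    rw [e2] at b4e
    funext i
    fin_cases i <;> simp_all
  -- combine the two dependencies, eliminating vertex 7
  obtain ⟨x, hx⟩ : ∃ x, x = w 3 * u 4 := ⟨_, rfl⟩
  have hC : ∀ i, (u 4 * w 0 - w 3 * u 0) * s i 0 - (w 3 * u 1) * s i 3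
      + (u 4 * w 1 - w 3 * u 2) * s i 4 + (u 4 * w 2) * s i 5
      - (w 3 * u 3) * s i 6 + (u 4 * w 4) * s i 8 = 0 := by
    intro i
    linear_combination u 4 * hW i - w 3 * hU i
  have g0 := hC 0
  rw [Z 0 0 (by simp [facets]), Z 0 3 (by simp [facets]), Z 0 5 (by simp [facets]), Z 0 6 (by simp [facets]), Z 0 8 (by simp [facets])] at g0
  have h4 : u 4 * w 1 - w 3 * u 2 = 0 := by
    have := Q 0 4 (by simp [facets])
    have h : (u 4 * w 1 - w 3 * u 2) * s 0 4 = 0 := by linarith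
    exact (mul_eq_zero.mp h).resolve_right this.ne'
  have g6 := hC 6
  rw [h4, Z 6 0 (by simp [facets]), Z 6 6 (by simp [facets]), Z 6 8 (by simp [facets])] at g6
  have g10 := hC 10
  rw [h4, Z 10 3 (by simp [facets]), Z 10 6 (by simp [facets]), Z 10 8 (by simp [facets])] at g10
  obtain ⟨k6, k6p, k6e⟩ := opp_aux (a := -(w 3 * u 1)) (b := u 4 * w 2)
    (Q 6 3 (by simp [facets])) (Q 6 5 (by simp [facets])) (by linarith)
  obtain ⟨k10, k10p, k10e⟩ := opp_aux (a := u 4 * w 0 - w 3 * u 0) (b := u 4 * w 2)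
    (Q 10 0 (by simp [facets])) (Q 10 5 (by simp [facets])) (by linarith)
  have hx0 : x ≠ 0 := by rw [hx]; exact mul_ne_zero hw3 hu4
  have q1 : b2 * x = - (k6 * (u 4 * w 2)) := by rw [← k6e, b2e, hx]; ring
  have q2 : - ((a2 + b3 * b2) * x) = - (k10 * (u 4 * w 2)) := by
    rw [← k10e, b3e, b2e, a2e, hx]; ring
  have q3 : (k10 * b2 + k6 * (a2 + b3 * b2)) * x = 0 := by
    linear_combination k10 * q1 - k6 * q2
  have : 0 < k10 * b2 + k6 * (a2 + b3 * b2) := by positivity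
  exact (mul_ne_zero this.ne' hx0) q3
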